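/- Extend ∂̄_F and ∂ z-coefficientwise to PV_S[z] and set D := ∂̄_F + z·∂. For each α = 1,…,μ define the operator T_α on PV_S[z] by T_α(a) := z·(∂a/∂s_α) + φ_α ∧ a, where ∂/∂s_α is applied to the polynomial coefficients. Then T_α commutes with D: T_α ∘ D = D ∘ T_α. (This is the commutation [∇_v^{PV}, ∂̄_F + z∂] = 0 for v = ∂/∂s_α, after clearing the factor z.) -/

import Mathlib

open MvPolynomial TensorProduct

set_option synthInstance.maxHeartbeats 1000000

noncomputable section

/-- The variables of `R_S[z]`: the `x`-variables, the unfolding parameters `s`, and `z`. -/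
abbrev SVars (N μ : ℕ) := (Fin N ⊕ Fin μ) ⊕ Unit

/-- `R_S[z]`, realized as the polynomial ring `ℂ[x₁,…,x_N,s₁,…,s_μ,z]`. -/
abbrev RSz (N μ : ℕ) := MvPolynomial (SVars N μ) ℂ

/-- The `x`-variables inside `R_S[z]`. -/
def xvar {N μ : ℕ} (k : Fin N) : SVars N μ := Sum.inl (Sum.inl k)

/-- The `s`-variables inside `R_S[z]`. -/
def svar {N μ : ℕ} (α : Fin μ) : SVars N μ := Sum.inl (Sum.inr α)

/-- The variable `z` inside `R_S[z]`. -/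
def zvar {N μ : ℕ} : SVars N μ := Sum.inr ()

/-- The inclusion `R = ℂ[x₁,…,x_N] → R_S[z]`. -/
def toRSz {N μ : ℕ} (p : MvPolynomial (Fin N) ℂ) : RSz N μ :=
  rename (xvar : Fin N → SVars N μ) p

/-- The unfolding `F = f + Σ_α s_α·φ_α ∈ R_S`. -/
def unfold {N μ : ℕ} (f : MvPolynomial (Fin N) ℂ) (φ : Fin μ → MvPolynomial (Fin N) ℂ) :
    RSz N μ :=
  toRSz f + ∑ α, X (svar α) * toRSz (φ α)

/-- The exterior algebra `⋀(ℂ^N)` on the generators `θ₁,…,θ_N`. -/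
abbrev ExtN (N : ℕ) := ExteriorAlgebra ℂ (Fin N → ℂ)

/-- `PV_S[z] = R_S[z] ⊗ ⋀(ℂ^N)`. -/
abbrev PVSz (N μ : ℕ) := RSz N μ ⊗[ℂ] ExtN N

/-- Contraction (interior product) with the `k`-th dual covector. -/
def contr {N : ℕ} (k : Fin N) : ExtN N →ₗ[ℂ] ExtN N :=
  CliffordAlgebra.contractLeft (LinearMap.proj k)

/-- The twisted differential `D = ∂̄_F + z∂` on `PV_S[z]`, acting by
`α ⊗ ω ↦ Σ_k ((∂F/∂x_k)·α + z·∂α/∂x_k) ⊗ ι_k(ω)` (derivatives in the `x`-variables). -/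
def DopS {N μ : ℕ} (f : MvPolynomial (Fin N) ℂ) (φ : Fin μ → MvPolynomial (Fin N) ℂ) :
    PVSz N μ →ₗ[ℂ] PVSz N μ :=
  ∑ k : Fin N, TensorProduct.map
    (LinearMap.mulLeft ℂ (pderiv (xvar k) (unfold f φ)) +
      LinearMap.mulLeft ℂ (X zvar) ∘ₗ (pderiv (xvar k)).toLinearMap)
    (contr k)

/-- The operator `T_α(a) = z·(∂a/∂s_α) + φ_α ∧ a` on `PV_S[z]` (i.e. `z·∇^{PV}_{∂/∂s_α}`). -/
def Tops {N μ : ℕ} (φ : Fin μ → MvPolynomial (Fin N) ℂ) (α : Fin μ) :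
    PVSz N μ →ₗ[ℂ] PVSz N μ :=
  TensorProduct.map (LinearMap.mulLeft ℂ (X zvar) ∘ₗ (pderiv (svar α)).toLinearMap)
      LinearMap.id +
    LinearMap.mulLeft ℂ ((toRSz (φ α) : RSz N μ) ⊗ₜ[ℂ] (1 : ExtN N))

theorem aux_comm {σ : Type*} (i j : σ) (p : MvPolynomial σ ℂ) :
    pderiv i (pderiv j p) = pderiv j (pderiv i p) := by
  classical
  have h : ⁅(pderiv i : Derivation ℂ (MvPolynomial σ ℂ) (MvPolynomial σ ℂ)),
      (pderiv j : Derivation ℂ (MvPolynomial σ ℂ) (MvPolynomial σ ℂ))⁆ = 0 := by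
    apply MvPolynomial.derivation_ext
    intro k
    rw [Derivation.commutator_apply, pderiv_X, pderiv_X]
    have h1 : ∀ a b : σ, (Pi.single a (1 : MvPolynomial σ ℂ) : σ → MvPolynomial σ ℂ) b
        = C (if b = a then 1 else 0) := by
      intro a b
      rw [Pi.single_apply]
      split_ifs <;> simp
    rw [h1, h1, pderiv_C, pderiv_C]
    simp
  have h2 := congrArg (fun d => d p) h
  simp only [Derivation.commutator_apply] at h2
  exact sub_eq_zero.mp h2

theorem aux_toRSz {N μ : ℕ} (α : Fin μ) (p : MvPolynomial (Fin N) ℂ) :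
    pderiv (svar α) (toRSz p : RSz N μ) = 0 := by
  classical
  apply pderiv_eq_zero_of_notMem_vars
  intro h
  have h' := vars_rename (xvar : Fin N → SVars N μ) p h
  simp [xvar, svar] at h'

theorem aux_unfold {N μ : ℕ} (f : MvPolynomial (Fin N) ℂ) (φ : Fin μ → MvPolynomial (Fin N) ℂ)
    (α : Fin μ) : pderiv (svar α) (unfold f φ) = (toRSz (φ α) : RSz N μ) := by
  classical
  unfold _root_.unfold
  rw [map_add, aux_toRSz, map_sum, zero_add, Finset.sum_eq_single α]
  · rw [Derivation.leibniz, aux_toRSz, pderiv_X_self]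
    simp
  · intro b _ hb
    rw [Derivation.leibniz, aux_toRSz, pderiv_X_of_ne]
    · simp
    · intro h
      apply hb
      simpa [svar] using h
  · simp

theorem aux_poly {N μ : ℕ} (f : MvPolynomial (Fin N) ℂ) (φ : Fin μ → MvPolynomial (Fin N) ℂ)
    (α : Fin μ) (k : Fin N) (a : RSz N μ) :
    X zvar * pderiv (svar α) (pderiv (xvar k) (unfold f φ) * a + X zvar * pderiv (xvar k) a)
      + toRSz (φ α) * (pderiv (xvar k) (unfold f φ) * a + X zvar * pderiv (xvar k) a)
    = (pderiv (xvar k) (unfold f φ) * (X zvar * pderiv (svar α) a)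
        + X zvar * pderiv (xvar k) (X zvar * pderiv (svar α) a))
      + (pderiv (xvar k) (unfold f φ) * (toRSz (φ α) * a)
        + X zvar * pderiv (xvar k) (toRSz (φ α) * a)) := by
  have hz1 : pderiv (svar α) (X zvar : RSz N μ) = 0 :=
    pderiv_X_of_ne (by simp [svar, zvar])
  have hz2 : pderiv (xvar k) (X zvar : RSz N μ) = 0 :=
    pderiv_X_of_ne (by simp [xvar, zvar])
  simp only [map_add, Derivation.leibniz, smul_eq_mul, hz1, hz2]
  rw [aux_comm (svar α) (xvar k) (unfold f φ), aux_unfold, aux_comm (svar α) (xvar k) a]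
  ring

theorem aux_D {N μ : ℕ} (f : MvPolynomial (Fin N) ℂ) (φ : Fin μ → MvPolynomial (Fin N) ℂ)
    (a : RSz N μ) (w : ExtN N) :
    DopS f φ (a ⊗ₜ[ℂ] w) = ∑ k : Fin N,
      (pderiv (xvar k) (unfold f φ) * a + X zvar * pderiv (xvar k) a) ⊗ₜ[ℂ] contr k w := by
  unfold DopS
  rw [LinearMap.sum_apply]
  rfl

theorem aux_T {N μ : ℕ} (φ : Fin μ → MvPolynomial (Fin N) ℂ) (α : Fin μ)
    (a : RSz N μ) (w : ExtN N) :
    Tops φ α (a ⊗ₜ[ℂ] w) =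
      (X zvar * pderiv (svar α) a + toRSz (φ α) * a) ⊗ₜ[ℂ] w := by
  unfold Tops
  rw [LinearMap.add_apply, TensorProduct.map_tmul, LinearMap.mulLeft_apply,
    Algebra.TensorProduct.tmul_mul_tmul, one_mul, TensorProduct.add_tmul]
  rfl

theorem aux_main {N μ : ℕ} (f : MvPolynomial (Fin N) ℂ) (φ : Fin μ → MvPolynomial (Fin N) ℂ)
    (α : Fin μ) (a : RSz N μ) (w : ExtN N) :
    Tops φ α (DopS f φ (a ⊗ₜ[ℂ] w)) = DopS f φ (Tops φ α (a ⊗ₜ[ℂ] w)) := by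
  rw [aux_T, aux_D, aux_D, map_sum]
  refine Finset.sum_congr rfl fun k _ => ?_
  rw [aux_T, aux_poly]
  congr 1
  rw [map_add]
  ring

/-- The operator `T_α = z∇^{PV}_{∂/∂s_α}` commutes with `D = ∂̄_F + z∂`:
`[∇^{PV}_{∂/∂s_α}, ∂̄_F + z∂] = 0`. -/
theorem Top_comm_DopS (N μ : ℕ) (hN : 0 < N) (hμ : 0 < μ)
    (f : MvPolynomial (Fin N) ℂ) (φ : Fin μ → MvPolynomial (Fin N) ℂ) (α : Fin μ) :
    Tops φ α ∘ₗ DopS f φ = DopS f φ ∘ₗ Tops φ α := by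
  refine TensorProduct.ext' fun a w => ?_
  exact aux_main f φ α a w
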